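/- Define, for integers s,t ≥ 0, Q(s,t) = P(s,t) / ( 1 + (1/12)·ρ(s)·ρ(t)·P(s,t) ), where ρ(s) = 2 − 4/((s+1)(s+2)) and P(s,t) = 3 − 6(3 + 4(s+t) + s^2 + st + t^2)/((s+3)(t+3)(s+t+1)). Then for every integer s ≥ 1, log Q(s,s) + log Q(s−1,s−1) − log Q(s−1,s) − log Q(s,s−1) = log( (2s+1)^3 (2s+3) / ((2s+2)^3 · 2s) ). -/

import Mathlib

/-- `ρ(s) = 2 − 4/((s+1)(s+2))`. -/
noncomputable def rhofun (s : ℕ) : ℝ := 2 - 4 / (((s:ℝ) + 1) * ((s:ℝ) + 2))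

/-- `P(s,t) = 3 − 6(3+4(s+t)+s²+st+t²)/((s+3)(t+3)(s+t+1))`. -/
noncomputable def Pfun (s t : ℕ) : ℝ :=
  3 - 6 * (3 + 4 * ((s:ℝ) + (t:ℝ)) + (s:ℝ) ^ 2 + (s:ℝ) * (t:ℝ) + (t:ℝ) ^ 2) /
    (((s:ℝ) + 3) * ((t:ℝ) + 3) * ((s:ℝ) + (t:ℝ) + 1))

/-- `Q(s,t) = P(s,t)/(1 + (1/12)ρ(s)ρ(t)P(s,t))`. -/
noncomputable def Qfun (s t : ℕ) : ℝ :=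
  Pfun s t / (1 + (1/12) * rhofun s * rhofun t * Pfun s t)

theorem Qfun_closed (s t : ℕ) : Qfun s t =
    3 * ((s:ℝ) + t + 3) * (s + 2) * (t + 2) / (2 * (s + 3) * (t + 3) * (s + t + 2)) := by
  have hP : Pfun s t = 3 * ((s:ℝ) + 1) * (t + 1) * (s + t + 3) /
      ((s + 3) * (t + 3) * (s + t + 1)) := by
    unfold Pfun
    field_simp
    ring
  have hr : ∀ s : ℕ, rhofun s = 2 * (s:ℝ) * (s + 3) / ((s + 1) * (s + 2)) := by
    intro s
    unfold rhofun
    field_simp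
    ring
  have hD : 1 + (1/12) * rhofun s * rhofun t * Pfun s t =
      2 * ((s:ℝ) + 1) * (t + 1) * (s + t + 2) / ((s + 2) * (t + 2) * (s + t + 1)) := by
    rw [hP, hr, hr]
    field_simp
    ring
  unfold Qfun
  rw [hD, hP]
  field_simp

theorem Qfun_pos (s t : ℕ) : 0 < Qfun s t := by
  rw [Qfun_closed]
  positivity

/-- For every integer `s ≥ 1`,
`log Q(s,s) + log Q(s−1,s−1) − log Q(s−1,s) − log Q(s,s−1)
  = log((2s+1)³(2s+3)/((2s+2)³·2s))`. -/
theorem log_Qfun_identity (s : ℕ) (hs : 1 ≤ s) :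
    Real.log (Qfun s s) + Real.log (Qfun (s - 1) (s - 1)) -
      Real.log (Qfun (s - 1) s) - Real.log (Qfun s (s - 1)) =
    Real.log ((2 * (s:ℝ) + 1) ^ 3 * (2 * (s:ℝ) + 3) /
      ((2 * (s:ℝ) + 2) ^ 3 * (2 * (s:ℝ)))) := by
  obtain ⟨n, rfl⟩ : ∃ n, s = n + 1 := ⟨s - 1, by omega⟩
  simp only [Nat.add_sub_cancel]
  rw [← Real.log_mul (Qfun_pos _ _).ne' (Qfun_pos _ _).ne',
    ← Real.log_div (mul_pos (Qfun_pos _ _) (Qfun_pos _ _)).ne' (Qfun_pos _ _).ne',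
    ← Real.log_div (div_pos (mul_pos (Qfun_pos _ _) (Qfun_pos _ _)) (Qfun_pos _ _)).ne'
      (Qfun_pos _ _).ne']
  congr 1
  simp only [Qfun_closed]
  push_cast
  have h1 : (n:ℝ) + 1 + (n + 1) + 2 ≠ 0 := by positivity
  have h2 : (n:ℝ) + (n + 1) + 3 ≠ 0 := by positivity
  have h3 : (n:ℝ) + 1 + n + 3 ≠ 0 := by positivity
  field_simp
  ring
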